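/- arXiv:2308.02839 — 2 statements merged into one kernel-verified Lean document; each statement's English description precedes it below -/
import Mathlib

section
/- A permutation w ∈ S_n is fully commutative if and only if w is 321-avoiding, i.e., there are no indices a < b < c in {1,…,n} with w(a) > w(b) > w(c) (equivalently, the Robinson–Schensted shape of w has at most two rows, i.e., w has no decreasing subsequence of length 3). -/
/-- The simple transposition `s_i = (i, i+1)` in the symmetric group `S_n`,
for `i ∈ {1, …, n−1}` (here indexed by `Fin (n-1)`). -/
def simpleTransposition {n : ℕ} (i : Fin (n - 1)) : Equiv.Perm (Fin n) :=
  Equiv.swap ⟨i.1, by have := i.isLt; omega⟩ ⟨i.1 + 1, by have := i.isLt; omega⟩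

/-- The permutation `s_{i_1} ⋯ s_{i_k}` determined by a word `(i_1, …, i_k)`. -/
def wordProd {n : ℕ} (l : List (Fin (n - 1))) : Equiv.Perm (Fin n) :=
  (l.map simpleTransposition).prod

/-- `l` is a reduced word for `w`: it is a word for `w` of minimal length. -/
def IsReducedWord {n : ℕ} (l : List (Fin (n - 1))) (w : Equiv.Perm (Fin n)) : Prop :=
  wordProd l = w ∧ ∀ l' : List (Fin (n - 1)), wordProd l' = w → l.length ≤ l'.length

/-- One commutation move: swap two adjacent letters `a`, `b` with `|a − b| ≥ 2`. -/
def CommStep {n : ℕ} (l l' : List (Fin (n - 1))) : Prop :=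
  ∃ (u v : List (Fin (n - 1))) (a b : Fin (n - 1)),
    (a.1 + 2 ≤ b.1 ∨ b.1 + 2 ≤ a.1) ∧
    l = u ++ a :: b :: v ∧ l' = u ++ b :: a :: v

/-- Two words are commutation-equivalent if one is obtained from the other by finitely
many commutation moves. -/
def CommEquiv {n : ℕ} (l l' : List (Fin (n - 1))) : Prop :=
  Relation.ReflTransGen CommStep l l'

/-- `w ∈ S_n` is fully commutative if any two reduced words for `w` are
commutation-equivalent. -/
def FullyCommutative {n : ℕ} (w : Equiv.Perm (Fin n)) : Prop :=
  ∀ l l' : List (Fin (n - 1)), IsReducedWord l w → IsReducedWord l' w → CommEquiv l l'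

/-- The position `i` exchanged by `simpleTransposition i`. -/
def lowPos {n : ℕ} (i : Fin (n - 1)) : Fin n := ⟨i.1, by have := i.isLt; omega⟩

/-- The position `i + 1` exchanged by `simpleTransposition i`. -/
def highPos {n : ℕ} (i : Fin (n - 1)) : Fin n := ⟨i.1 + 1, by have := i.isLt; omega⟩

/-- The inversions of `w`: the pairs of positions `a < b` with `w b < w a`. -/
def inversions {n : ℕ} (w : Equiv.Perm (Fin n)) : Finset (Fin n × Fin n) :=
  Finset.univ.filter fun p => p.1 < p.2 ∧ w p.2 < w p.1

/-- `w` contains the pattern `321`. -/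
def Contains321 {n : ℕ} (w : Equiv.Perm (Fin n)) : Prop :=
  ∃ a b c : Fin n, a < b ∧ b < c ∧ w b < w a ∧ w c < w b

section SimpleTransposition

variable {n : ℕ}

theorem simpleTransposition_eq_swap (i : Fin (n - 1)) :
    simpleTransposition i = Equiv.swap (lowPos i) (highPos i) := rfl

theorem simpleTransposition_low (i : Fin (n - 1)) :
    simpleTransposition i (lowPos i) = highPos i := Equiv.swap_apply_left _ _

theorem simpleTransposition_high (i : Fin (n - 1)) :
    simpleTransposition i (highPos i) = lowPos i := Equiv.swap_apply_right _ _

theorem simpleTransposition_of_ne {i : Fin (n - 1)} {a : Fin n} (hl : a.1 ≠ i.1)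
    (hh : a.1 ≠ i.1 + 1) : simpleTransposition i a = a :=
  Equiv.swap_apply_of_ne_of_ne (fun h => hl (congrArg Fin.val h))
    (fun h => hh (congrArg Fin.val h))

theorem simpleTransposition_mul_self (i : Fin (n - 1)) :
    simpleTransposition i * simpleTransposition i = 1 := Equiv.swap_mul_self _ _

theorem mul_simpleTransposition_cancel (w : Equiv.Perm (Fin n)) (i : Fin (n - 1)) :
    w * simpleTransposition i * simpleTransposition i = w := by
  rw [mul_assoc, simpleTransposition_mul_self, mul_one]

theorem simpleTransposition_involutive (i : Fin (n - 1)) (a : Fin n) :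
    simpleTransposition i (simpleTransposition i a) = a := by
  rw [← Equiv.Perm.mul_apply, simpleTransposition_mul_self, Equiv.Perm.one_apply]

theorem simpleTransposition_val (i : Fin (n - 1)) (a : Fin n) :
    (simpleTransposition i a).1 =
      if a.1 = i.1 then i.1 + 1 else if a.1 = i.1 + 1 then i.1 else a.1 := by
  simp only [simpleTransposition_eq_swap, Equiv.swap_apply_def, lowPos, highPos, Fin.ext_iff]
  split_ifs <;> rfl

theorem simpleTransposition_lt {i : Fin (n - 1)} {a b : Fin n} (hab : a < b)
    (h : ¬ (a = lowPos i ∧ b = highPos i)) :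
    simpleTransposition i a < simpleTransposition i b := by
  simp only [lowPos, highPos, Fin.ext_iff] at h
  rw [Fin.lt_def] at hab ⊢
  rw [simpleTransposition_val, simpleTransposition_val]
  split_ifs <;> omega

theorem simpleTransposition_comm {i j : Fin (n - 1)} (h : i.1 + 2 ≤ j.1 ∨ j.1 + 2 ≤ i.1) :
    simpleTransposition i * simpleTransposition j =
      simpleTransposition j * simpleTransposition i := by
  ext a
  simp only [Equiv.Perm.mul_apply, simpleTransposition_val]
  split_ifs <;> omega

theorem simpleTransposition_braid {i j : Fin (n - 1)} (h : j.1 = i.1 + 1) :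
    simpleTransposition i * simpleTransposition j * simpleTransposition i =
      simpleTransposition j * simpleTransposition i * simpleTransposition j := by
  have hlow : highPos i = lowPos j := Fin.ext h.symm
  have hij : lowPos i ≠ lowPos j := Fin.ne_of_val_ne (by simp only [lowPos]; omega)
  have hij' : lowPos i ≠ highPos j :=
    Fin.ne_of_val_ne (by simp only [lowPos, highPos]; omega)
  have hjj : lowPos j ≠ highPos j := Fin.ne_of_val_ne (by simp only [lowPos, highPos]; omega)
  simp only [simpleTransposition_eq_swap, hlow]
  rw [Equiv.swap_mul_swap_mul_swap hij hij', Equiv.swap_comm (lowPos i),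
    Equiv.swap_comm (lowPos j) (highPos j),
    Equiv.swap_mul_swap_mul_swap hjj.symm hij'.symm, Equiv.swap_comm]

end SimpleTransposition

section Inversions

variable {n : ℕ}

theorem mem_inversions {w : Equiv.Perm (Fin n)} {p : Fin n × Fin n} :
    p ∈ inversions w ↔ p.1 < p.2 ∧ w p.2 < w p.1 := by
  simp [inversions]

theorem lowPos_lt_highPos (i : Fin (n - 1)) : lowPos i < highPos i := by
  simp [lowPos, highPos, Fin.lt_def]

/-- An inversion of `w * s_i` is carried by `s_i` to an inversion of `w` if `w` has a descent
at `i`. -/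
theorem inversion_of_mul_simpleTransposition {w : Equiv.Perm (Fin n)} {i : Fin (n - 1)}
    (hd : w (highPos i) < w (lowPos i)) {a b : Fin n} (hab : a < b)
    (h : w (simpleTransposition i b) < w (simpleTransposition i a)) :
    simpleTransposition i a < simpleTransposition i b := by
  refine simpleTransposition_lt hab ?_
  rintro ⟨rfl, rfl⟩
  rw [simpleTransposition_low, simpleTransposition_high] at h
  exact lt_asymm h hd

theorem card_inversions_mul_of_descent {w : Equiv.Perm (Fin n)} {i : Fin (n - 1)}
    (hd : w (highPos i) < w (lowPos i)) :
    (inversions (w * simpleTransposition i)).card + 1 = (inversions w).card := by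
  have hmem : (lowPos i, highPos i) ∈ inversions w :=
    mem_inversions.2 ⟨lowPos_lt_highPos i, hd⟩
  rw [← Finset.card_erase_add_one hmem]
  congr 1
  refine Finset.card_nbij'
    (fun p => (simpleTransposition i p.1, simpleTransposition i p.2))
    (fun p => (simpleTransposition i p.1, simpleTransposition i p.2)) ?_ ?_ ?_ ?_
  · rintro ⟨a, b⟩ hp
    obtain ⟨hab, hw⟩ := mem_inversions.1 (Finset.mem_coe.1 hp)
    refine Finset.mem_coe.2 (Finset.mem_erase.2 ⟨?_, mem_inversions.2
      ⟨inversion_of_mul_simpleTransposition hd hab hw, hw⟩⟩)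
    intro h
    have ha := congrArg (simpleTransposition i) (Prod.ext_iff.1 h).1
    have hb := congrArg (simpleTransposition i) (Prod.ext_iff.1 h).2
    simp only [simpleTransposition_involutive, simpleTransposition_low,
      simpleTransposition_high] at ha hb
    have := lowPos_lt_highPos i
    dsimp only at hab
    rw [ha, hb] at hab
    exact lt_asymm hab this
  · rintro ⟨a, b⟩ hp
    obtain ⟨hne, hp⟩ := Finset.mem_erase.1 (Finset.mem_coe.1 hp)
    obtain ⟨hab, hw⟩ := mem_inversions.1 hp
    refine Finset.mem_coe.2 (mem_inversions.2 ⟨simpleTransposition_lt hab ?_, ?_⟩)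
    · rintro ⟨ha, hb⟩
      exact hne (Prod.ext ha hb)
    · simpa only [Equiv.Perm.mul_apply, simpleTransposition_involutive] using hw
  · rintro ⟨a, b⟩ -
    simp only [simpleTransposition_involutive]
  · rintro ⟨a, b⟩ -
    simp only [simpleTransposition_involutive]

theorem card_inversions_mul_of_not_descent {w : Equiv.Perm (Fin n)} {i : Fin (n - 1)}
    (hd : ¬ w (highPos i) < w (lowPos i)) :
    (inversions (w * simpleTransposition i)).card = (inversions w).card + 1 := by
  have hlt : w (lowPos i) < w (highPos i) :=
    lt_of_le_of_ne (not_lt.1 hd) (w.injective.ne (lowPos_lt_highPos i).ne)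
  have := card_inversions_mul_of_descent (w := w * simpleTransposition i) (i := i) (by
    simpa only [Equiv.Perm.mul_apply, simpleTransposition_low, simpleTransposition_high]
      using hlt)
  rw [mul_simpleTransposition_cancel] at this
  exact this.symm

theorem inversions_one : inversions (1 : Equiv.Perm (Fin n)) = ∅ := by
  ext p
  simp only [mem_inversions, Equiv.Perm.one_apply, Finset.notMem_empty, iff_false]
  exact fun h => lt_asymm h.1 h.2

theorem exists_descent_of_ne_one {w : Equiv.Perm (Fin n)} (hw : w ≠ 1) :
    ∃ i : Fin (n - 1), w (highPos i) < w (lowPos i) := by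
  by_contra! h
  refine hw ?_
  obtain _ | n := n
  · exact Subsingleton.elim _ _
  have hmono : StrictMono w := Fin.strictMono_iff_lt_succ.2 fun i =>
    lt_of_le_of_ne (h i) (w.injective.ne i.castSucc_lt_succ.ne)
  ext a
  have := Subsingleton.elim (hmono.orderIsoOfSurjective w w.surjective) (OrderIso.refl _)
  exact congrArg Fin.val (DFunLike.congr_fun this a)

end Inversions

section Words

variable {n : ℕ}

theorem wordProd_concat (l : List (Fin (n - 1))) (i : Fin (n - 1)) :
    wordProd (l ++ [i]) = wordProd l * simpleTransposition i := by
  simp [wordProd]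

theorem card_inversions_wordProd_le (l : List (Fin (n - 1))) :
    (inversions (wordProd l)).card ≤ l.length := by
  induction l using List.reverseRecOn with
  | nil => simp [wordProd, inversions_one]
  | append_singleton l i ih =>
    rw [wordProd_concat, List.length_append, List.length_singleton]
    by_cases hd : wordProd l (highPos i) < wordProd l (lowPos i)
    · have := card_inversions_mul_of_descent hd
      omega
    · have := card_inversions_mul_of_not_descent hd
      omega

theorem exists_word_length_eq_card_inversions (w : Equiv.Perm (Fin n)) :
    ∃ l : List (Fin (n - 1)), wordProd l = w ∧ l.length = (inversions w).card := by
  induction hk : (inversions w).card generalizing w with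
  | zero =>
    refine ⟨[], ?_, rfl⟩
    by_contra hw
    obtain ⟨i, hd⟩ := exists_descent_of_ne_one (w := w) (fun h => hw (by simp [wordProd, h]))
    have := card_inversions_mul_of_descent hd
    omega
  | succ k ih =>
    have hw : w ≠ 1 := by
      rintro rfl
      simp [inversions_one] at hk
    obtain ⟨i, hd⟩ := exists_descent_of_ne_one hw
    have hcard := card_inversions_mul_of_descent hd
    obtain ⟨l, hl, hlen⟩ := ih (w * simpleTransposition i) (by omega)
    exact ⟨l ++ [i], by rw [wordProd_concat, hl, mul_simpleTransposition_cancel], by simp [hlen]⟩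

theorem isReducedWord_iff {l : List (Fin (n - 1))} {w : Equiv.Perm (Fin n)} :
    IsReducedWord l w ↔ wordProd l = w ∧ l.length = (inversions w).card := by
  refine ⟨fun ⟨hl, hmin⟩ => ⟨hl, ?_⟩, fun ⟨hl, hlen⟩ => ⟨hl, fun l' hl' => ?_⟩⟩
  · obtain ⟨l', hl', hlen⟩ := exists_word_length_eq_card_inversions w
    exact le_antisymm (hlen ▸ hmin l' hl') (hl ▸ card_inversions_wordProd_le l)
  · rw [hlen, ← hl']
    exact card_inversions_wordProd_le l'

theorem exists_isReducedWord (w : Equiv.Perm (Fin n)) : ∃ l, IsReducedWord l w :=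
  (exists_word_length_eq_card_inversions w).imp fun _ => isReducedWord_iff.2

theorem IsReducedWord.concat {l : List (Fin (n - 1))} {w : Equiv.Perm (Fin n)} {i : Fin (n - 1)}
    (hd : w (highPos i) < w (lowPos i)) (hl : IsReducedWord l (w * simpleTransposition i)) :
    IsReducedWord (l ++ [i]) w := by
  obtain ⟨hprod, hlen⟩ := isReducedWord_iff.1 hl
  refine isReducedWord_iff.2 ⟨?_, ?_⟩
  · rw [wordProd_concat, hprod, mul_simpleTransposition_cancel]
  · rw [List.length_append, List.length_singleton, hlen, card_inversions_mul_of_descent hd]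

theorem IsReducedWord.of_concat {l : List (Fin (n - 1))} {w : Equiv.Perm (Fin n)}
    {i : Fin (n - 1)} (h : IsReducedWord (l ++ [i]) w) :
    w (highPos i) < w (lowPos i) ∧ IsReducedWord l (w * simpleTransposition i) := by
  obtain ⟨hprod, hlen⟩ := isReducedWord_iff.1 h
  have hl : wordProd l = w * simpleTransposition i := by
    rw [← hprod, wordProd_concat, mul_simpleTransposition_cancel]
  have hle := card_inversions_wordProd_le l
  rw [hl] at hle
  rw [List.length_append, List.length_singleton] at hlen
  have hd : w (highPos i) < w (lowPos i) := by
    by_contra hd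
    have := card_inversions_mul_of_not_descent hd
    omega
  have := card_inversions_mul_of_descent hd
  exact ⟨hd, isReducedWord_iff.2 ⟨hl, by omega⟩⟩

theorem CommEquiv.append_right {l l' : List (Fin (n - 1))} (h : CommEquiv l l')
    (t : List (Fin (n - 1))) : CommEquiv (l ++ t) (l' ++ t) := by
  refine Relation.ReflTransGen.lift (· ++ t) ?_ _ _ h
  rintro _ _ ⟨u, v, a, b, hab, rfl, rfl⟩
  exact ⟨u, v ++ t, a, b, hab, by simp, by simp⟩

theorem CommEquiv.perm {l l' : List (Fin (n - 1))} (h : CommEquiv l l') : l.Perm l' := by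
  induction h with
  | refl => exact List.Perm.refl _
  | tail _ hstep ih =>
    obtain ⟨u, v, a, b, -, rfl, rfl⟩ := hstep
    exact ih.trans ((List.Perm.swap b a v).append_left u)

end Words

section Pattern

variable {n : ℕ}

theorem Contains321.of_mul_simpleTransposition {w : Equiv.Perm (Fin n)} {i : Fin (n - 1)}
    (hd : w (highPos i) < w (lowPos i)) (h : Contains321 (w * simpleTransposition i)) :
    Contains321 w := by
  obtain ⟨a, b, c, hab, hbc, hwab, hwbc⟩ := h
  exact ⟨_, _, _, inversion_of_mul_simpleTransposition hd hab hwab,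
    inversion_of_mul_simpleTransposition hd hbc hwbc, hwab, hwbc⟩

theorem contains321_of_adjacent_descents {w : Equiv.Perm (Fin n)} {i j : Fin (n - 1)}
    (hij : j.1 = i.1 + 1) (hi : w (highPos i) < w (lowPos i))
    (hj : w (highPos j) < w (lowPos j)) : Contains321 w := by
  have h : lowPos j = highPos i := Fin.ext hij
  have hlt := lowPos_lt_highPos j
  rw [h] at hj hlt
  exact ⟨_, _, _, lowPos_lt_highPos i, hlt, hi, hj⟩

theorem commEquiv_of_not_contains321 (l : List (Fin (n - 1))) :
    ∀ (l' : List (Fin (n - 1))) (w : Equiv.Perm (Fin n)), ¬ Contains321 w →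
      IsReducedWord l w → IsReducedWord l' w → CommEquiv l l' := by
  induction hk : l.length generalizing l with
  | zero =>
    intro l' w _ hl hl'
    have := (isReducedWord_iff.1 hl).2.trans (isReducedWord_iff.1 hl').2.symm
    rw [List.length_eq_zero_iff.1 hk, List.length_eq_zero_iff.1 (this.symm.trans hk)]
    exact Relation.ReflTransGen.refl
  | succ k ih =>
    intro l' w hw hl hl'
    have hlen := (isReducedWord_iff.1 hl).2.trans (isReducedWord_iff.1 hl').2.symm
    obtain rfl | ⟨u, i, rfl⟩ := l.eq_nil_or_concat'
    · simp at hk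
    obtain rfl | ⟨u', j, rfl⟩ := l'.eq_nil_or_concat'
    · simp at hlen
    simp only [List.length_append, List.length_singleton, Nat.add_right_cancel_iff] at hk hlen
    obtain ⟨hi, hu⟩ := hl.of_concat
    obtain ⟨hj, hu'⟩ := hl'.of_concat
    have hwi : ¬ Contains321 (w * simpleTransposition i) :=
      fun h => hw (h.of_mul_simpleTransposition hi)
    have hwj : ¬ Contains321 (w * simpleTransposition j) :=
      fun h => hw (h.of_mul_simpleTransposition hj)
    by_cases hij : i = j
    · subst hij
      exact (ih u hk u' _ hwi hu hu').append_right [i]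
    have hne : i.1 ≠ j.1 := fun h => hij (Fin.ext h)
    have hij₁ : j.1 ≠ i.1 + 1 := fun h => hw (contains321_of_adjacent_descents h hi hj)
    have hji₁ : i.1 ≠ j.1 + 1 := fun h => hw (contains321_of_adjacent_descents h hj hi)
    have hfar : i.1 + 2 ≤ j.1 ∨ j.1 + 2 ≤ i.1 := by omega
    have hj' : (w * simpleTransposition i) (highPos j) <
        (w * simpleTransposition i) (lowPos j) := by
      rw [Equiv.Perm.mul_apply, Equiv.Perm.mul_apply,
        simpleTransposition_of_ne (a := highPos j), simpleTransposition_of_ne (a := lowPos j)]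
      · exact hj
      all_goals simp only [lowPos, highPos]; omega
    have hi' : (w * simpleTransposition j) (highPos i) <
        (w * simpleTransposition j) (lowPos i) := by
      rw [Equiv.Perm.mul_apply, Equiv.Perm.mul_apply,
        simpleTransposition_of_ne (a := highPos i), simpleTransposition_of_ne (a := lowPos i)]
      · exact hi
      all_goals simp only [lowPos, highPos]; omega
    obtain ⟨v, hv⟩ := exists_isReducedWord (w * simpleTransposition i * simpleTransposition j)
    have hvj : IsReducedWord (v ++ [j]) (w * simpleTransposition i) := hv.concat hj'
    have hvi : IsReducedWord (v ++ [i]) (w * simpleTransposition j) := by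
      refine IsReducedWord.concat hi' ?_
      rwa [mul_assoc, ← simpleTransposition_comm hfar, ← mul_assoc]
    have hvi_len : (v ++ [i]).length = k := by
      have := (isReducedWord_iff.1 hu).2.trans (isReducedWord_iff.1 hvj).2.symm
      simp only [List.length_append, List.length_singleton] at this ⊢
      omega
    have hleft := (ih u hk _ _ hwi hu hvj).append_right [i]
    have hright := (ih _ hvi_len u' _ hwj hvi hu').append_right [j]
    refine hleft.trans (Relation.ReflTransGen.head ⟨v, [], j, i, hfar.symm, ?_, ?_⟩ hright) <;>
      simp

/-- A permutation whose values strictly decrease on three consecutive positions has two reduced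
words related by a braid move. -/
theorem exists_not_perm_of_adjacent_descents {w : Equiv.Perm (Fin n)} {i j : Fin (n - 1)}
    (hij : j.1 = i.1 + 1) (hi : w (highPos i) < w (lowPos i))
    (hj : w (highPos j) < w (lowPos j)) :
    ∃ l l', IsReducedWord l w ∧ IsReducedWord l' w ∧ ¬ l.Perm l' := by
  have hlow : lowPos j = highPos i := Fin.ext hij
  have hlow_i : simpleTransposition j (lowPos i) = lowPos i :=
    simpleTransposition_of_ne (by simp only [lowPos]; omega) (by simp only [lowPos]; omega)
  have hhigh_j : simpleTransposition i (highPos j) = highPos j :=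
    simpleTransposition_of_ne (by simp only [highPos]; omega) (by simp only [highPos]; omega)
  have hhigh_i : simpleTransposition j (highPos i) = highPos j := by
    rw [← hlow, simpleTransposition_low]
  obtain ⟨v, hv⟩ := exists_isReducedWord
    (w * simpleTransposition i * simpleTransposition j * simpleTransposition i)
  have hred : IsReducedWord (v ++ [i] ++ [j] ++ [i]) w := by
    refine IsReducedWord.concat hi (IsReducedWord.concat ?_ (IsReducedWord.concat ?_ hv))
    · rw [Equiv.Perm.mul_apply, Equiv.Perm.mul_apply, hhigh_j, hlow, simpleTransposition_high]
      exact hj.trans (hlow ▸ hi)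
    · simp only [Equiv.Perm.mul_apply]
      rw [hhigh_i, hhigh_j, hlow_i, simpleTransposition_low, ← hlow]
      exact hj
  obtain ⟨hprod, hlen⟩ := isReducedWord_iff.1 hred
  refine ⟨v ++ [i] ++ [j] ++ [i], v ++ [j] ++ [i] ++ [j], hred,
    isReducedWord_iff.2 ⟨?_, ?_⟩, fun h => ?_⟩
  · rw [← hprod]
    have := simpleTransposition_braid hij
    simp only [wordProd_concat, mul_assoc] at this ⊢
    rw [this]
  · rw [← hlen]
    simp
  · have hne : i ≠ j := fun h => by
      rw [h] at hij
      omega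
    have := h.count_eq i
    simp [List.count_append, hne.symm] at this

theorem exists_not_perm_of_descent {w : Equiv.Perm (Fin n)} {i : Fin (n - 1)}
    (hd : w (highPos i) < w (lowPos i))
    (h : ∃ l l', IsReducedWord l (w * simpleTransposition i) ∧
      IsReducedWord l' (w * simpleTransposition i) ∧ ¬ l.Perm l') :
    ∃ l l', IsReducedWord l w ∧ IsReducedWord l' w ∧ ¬ l.Perm l' := by
  obtain ⟨l, l', hl, hl', hne⟩ := h
  exact ⟨l ++ [i], l' ++ [i], hl.concat hd, hl'.concat hd,
    fun h => hne ((List.perm_append_right_iff [i]).1 h)⟩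

theorem exists_not_perm_of_contains321 (k : ℕ) :
    ∀ (w : Equiv.Perm (Fin n)) (a b c : Fin n), c.1 - a.1 = k → a < b → b < c →
      w b < w a → w c < w b →
      ∃ l l', IsReducedWord l w ∧ IsReducedWord l' w ∧ ¬ l.Perm l' := by
  induction k with
  | zero =>
    intro w a b c hk hab hbc
    rw [Fin.lt_def] at hab hbc
    omega
  | succ k ih =>
    intro w a b c hk hab hbc hwab hwbc
    have hab' := Fin.lt_def.1 hab
    have hbc' := Fin.lt_def.1 hbc
    have hc := c.isLt
    by_cases hb : a.1 + 1 < b.1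
    · let i : Fin (n - 1) := ⟨a.1, by omega⟩
      have hne : w (highPos i) ≠ w b :=
        w.injective.ne (Fin.ne_of_val_ne (by simp only [highPos, i]; omega))
      rcases lt_or_gt_of_ne hne with hlt | hgt
      · refine exists_not_perm_of_descent (i := i) (hlt.trans hwab)
          (ih _ (highPos i) b c ?_ (Fin.lt_def.2 hb) hbc ?_ ?_)
        · simp only [highPos, i]
          omega
        · rw [Equiv.Perm.mul_apply, Equiv.Perm.mul_apply, simpleTransposition_high,
            simpleTransposition_of_ne]
          · exact hwab
          all_goals simp only [i]; omega
        · rw [Equiv.Perm.mul_apply, Equiv.Perm.mul_apply, simpleTransposition_of_ne,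
            simpleTransposition_of_ne]
          · exact hwbc
          all_goals simp only [i]; omega
      · exact ih w (highPos i) b c (by simp only [highPos, i]; omega) (Fin.lt_def.2 hb) hbc hgt hwbc
    by_cases hb' : b.1 + 1 < c.1
    · let i : Fin (n - 1) := ⟨c.1 - 1, by omega⟩
      have hci : highPos i = c := Fin.ext (by simp only [highPos, i]; omega)
      have hbi : b < lowPos i := Fin.lt_def.2 (by simp only [lowPos, i]; omega)
      rcases lt_or_gt_of_ne (w.injective.ne hbi.ne) with hlt | hgt
      · refine exists_not_perm_of_descent (i := i) (by rw [hci]; exact hwbc.trans hlt)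
          (ih _ a b (lowPos i) ?_ hab hbi ?_ ?_)
        · simp only [lowPos, i]
          omega
        · rw [Equiv.Perm.mul_apply, Equiv.Perm.mul_apply, simpleTransposition_of_ne,
            simpleTransposition_of_ne]
          · exact hwab
          all_goals simp only [i]; omega
        · rw [Equiv.Perm.mul_apply, Equiv.Perm.mul_apply, simpleTransposition_low, hci,
            simpleTransposition_of_ne]
          · exact hwbc
          all_goals simp only [i]; omega
      · exact ih w a b (lowPos i) (by simp only [lowPos, i]; omega) hab hbi hwab hgt
    have hba : b.1 = a.1 + 1 := by omega
    have hcb : c.1 = b.1 + 1 := by omega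
    refine exists_not_perm_of_adjacent_descents (i := ⟨a.1, by omega⟩) (j := ⟨b.1, by omega⟩)
      hba ?_ ?_
    · convert hwab using 2
      exacts [Fin.ext hba.symm, rfl]
    · convert hwbc using 2
      exacts [Fin.ext hcb.symm, rfl]

end Pattern

/-- A permutation `w ∈ S_n` is fully commutative if and only if it is `321`-avoiding,
i.e. there are no `a < b < c` with `w(a) > w(b) > w(c)`. -/
theorem fullyCommutative_iff_321_avoiding {n : ℕ} (w : Equiv.Perm (Fin n)) :
    FullyCommutative w ↔
      ¬ ∃ a b c : Fin n, a < b ∧ b < c ∧ w b < w a ∧ w c < w b := by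
  refine ⟨fun hw => ?_, fun hw l l' => commEquiv_of_not_contains321 l l' w hw⟩
  rintro ⟨a, b, c, hab, hbc, hwab, hwbc⟩
  obtain ⟨l, l', hl, hl', hne⟩ := exists_not_perm_of_contains321 _ w a b c rfl hab hbc hwab hwbc
  exact hne (hw l l' hl hl').perm
end

section
/- For every n ≥ 1, the number of fully commutative elements of S_n equals the n-th Catalan number (1/(n+1))·C(2n, n). -/
namespace FullyCommutativeCount

open Equiv Finset

variable {n : ℕ}

/-! ### Inversions and reduced words -/

/-- The smaller of the two points moved by `simpleTransposition a`. -/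
def lo (a : Fin (n - 1)) : Fin n := ⟨a.1, by have := a.isLt; omega⟩

/-- The larger of the two points moved by `simpleTransposition a`. -/
def hi (a : Fin (n - 1)) : Fin n := ⟨a.1 + 1, by have := a.isLt; omega⟩

@[simp] lemma lo_val (a : Fin (n - 1)) : (lo a).1 = a.1 := rfl

@[simp] lemma hi_val (a : Fin (n - 1)) : (hi a).1 = a.1 + 1 := rfl

lemma lo_lt_hi (a : Fin (n - 1)) : lo a < hi a := by simp [Fin.lt_def]

@[simp] lemma simpleTransposition_lo (a : Fin (n - 1)) :
    simpleTransposition a (lo a) = hi a := swap_apply_left _ _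

@[simp] lemma simpleTransposition_hi (a : Fin (n - 1)) :
    simpleTransposition a (hi a) = lo a := swap_apply_right _ _

lemma simpleTransposition_of_ne (a : Fin (n - 1)) {x : Fin n} (h : x ≠ lo a) (h' : x ≠ hi a) :
    simpleTransposition a x = x := swap_apply_of_ne_of_ne h h'

@[simp] lemma simpleTransposition_mul_self (a : Fin (n - 1)) :
    simpleTransposition a * simpleTransposition a = 1 := swap_mul_self _ _

@[simp] lemma simpleTransposition_apply_self (a : Fin (n - 1)) (x : Fin n) :
    simpleTransposition a (simpleTransposition a x) = x := swap_apply_self _ _ _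

@[simp] lemma simpleTransposition_inv (a : Fin (n - 1)) :
    (simpleTransposition a)⁻¹ = simpleTransposition a := swap_inv _ _

lemma simpleTransposition_val (a : Fin (n - 1)) (x : Fin n) :
    (simpleTransposition a x).1 =
      if x.1 = a.1 then a.1 + 1 else if x.1 = a.1 + 1 then a.1 else x.1 := by
  rw [simpleTransposition, swap_apply_def]
  simp only [Fin.ext_iff]
  split_ifs <;> rfl

lemma simpleTransposition_lt (a : Fin (n - 1)) {x y : Fin n} (h : x < y)
    (hne : ¬(x = lo a ∧ y = hi a)) : simpleTransposition a x < simpleTransposition a y := by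
  rw [Fin.lt_def, simpleTransposition_val, simpleTransposition_val]
  simp only [Fin.ext_iff, lo_val, hi_val, Fin.lt_def] at *
  split_ifs <;> omega

/-- The inversions of a permutation, as pairs of positions. -/
def inversions (p : Perm (Fin n)) : Finset (Fin n × Fin n) :=
  univ.filter fun x => x.1 < x.2 ∧ p x.2 < p x.1

@[simp] lemma mem_inversions {p : Perm (Fin n)} {x : Fin n × Fin n} :
    x ∈ inversions p ↔ x.1 < x.2 ∧ p x.2 < p x.1 := by simp [inversions]

lemma card_inversions_mul_of_lt {p : Perm (Fin n)} {a : Fin (n - 1)} (h : p (lo a) < p (hi a)) :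
    (inversions (p * simpleTransposition a)).card = (inversions p).card + 1 := by
  have key : inversions (p * simpleTransposition a) = insert (lo a, hi a)
      ((inversions p).map ((simpleTransposition a).prodCongr
        (simpleTransposition a)).toEmbedding) := by
    ext ⟨x, y⟩
    simp only [mem_inversions, Perm.mul_apply, mem_insert, mem_map_equiv, Prod.mk.injEq,
      prodCongr_symm, prodCongr_apply, Prod.map]
    have hs : (simpleTransposition a).symm = simpleTransposition a := simpleTransposition_inv a
    rw [hs]
    constructor
    · rintro ⟨hxy, hp⟩
      by_cases hc : x = lo a ∧ y = hi a
      · exact Or.inl hc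
      · exact Or.inr ⟨simpleTransposition_lt a hxy hc, hp⟩
    · rintro (⟨rfl, rfl⟩ | ⟨hxy, hp⟩)
      · simpa using ⟨lo_lt_hi a, h⟩
      · refine ⟨?_, hp⟩
        have := simpleTransposition_lt a hxy (fun hc => ?_)
        · simpa using this
        · rw [hc.1, hc.2] at hp
          exact lt_asymm h hp
  rw [key, card_insert_of_notMem, card_map]
  simp only [mem_map_equiv, prodCongr_symm, prodCongr_apply, Prod.map, mem_inversions]
  have hs : (simpleTransposition a).symm = simpleTransposition a := simpleTransposition_inv a
  rw [hs, simpleTransposition_lo, simpleTransposition_hi]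
  exact fun hc => lt_asymm hc.1 (lo_lt_hi a)

lemma card_inversions_mul_of_gt {p : Perm (Fin n)} {a : Fin (n - 1)} (h : p (hi a) < p (lo a)) :
    (inversions (p * simpleTransposition a)).card + 1 = (inversions p).card := by
  have := card_inversions_mul_of_lt (p := p * simpleTransposition a) (a := a) (by simpa using h)
  rw [mul_assoc, simpleTransposition_mul_self, mul_one] at this
  exact this.symm

lemma lt_or_gt_lo_hi (p : Perm (Fin n)) (a : Fin (n - 1)) :
    p (lo a) < p (hi a) ∨ p (hi a) < p (lo a) :=
  lt_or_gt_of_ne fun h => (lo_lt_hi a).ne (p.injective h)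

lemma eq_one_of_forall_lt {p : Perm (Fin n)} (h : ∀ a, p (lo a) < p (hi a)) : p = 1 := by
  cases n with
  | zero => exact Subsingleton.elim _ _
  | succ m =>
    have hm : StrictMono p := Fin.strictMono_iff_lt_succ.2 fun i => h i
    have he : hm.orderIsoOfSurjective p p.surjective = OrderIso.refl _ := Subsingleton.elim _ _
    ext x
    exact congrArg Fin.val (DFunLike.congr_fun he x)

@[simp] lemma wordProd_cons (a : Fin (n - 1)) (l : List (Fin (n - 1))) :
    wordProd (a :: l) = simpleTransposition a * wordProd l := by simp [wordProd]

@[simp] lemma inversions_one : inversions (1 : Perm (Fin n)) = ∅ := by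
  ext x
  simpa using fun h => le_of_lt h

lemma card_inversions_le_length (l : List (Fin (n - 1))) :
    (inversions (wordProd l)⁻¹).card ≤ l.length := by
  induction l with
  | nil => simp [wordProd]
  | cons a l ih =>
    rw [wordProd_cons, mul_inv_rev, simpleTransposition_inv, List.length_cons]
    rcases lt_or_gt_lo_hi (wordProd l)⁻¹ a with h | h
    · have := card_inversions_mul_of_lt h
      omega
    · have := card_inversions_mul_of_gt h
      omega

/-- `l` is a word for the inverse of `p`, of length the number of inversions of `p`. -/
def IsShortWord (l : List (Fin (n - 1))) (p : Perm (Fin n)) : Prop :=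
  wordProd l = p⁻¹ ∧ l.length = (inversions p).card

lemma IsShortWord.cons {l : List (Fin (n - 1))} {p : Perm (Fin n)} {a : Fin (n - 1)}
    (h : p (hi a) < p (lo a)) (hl : IsShortWord l (p * simpleTransposition a)) :
    IsShortWord (a :: l) p := by
  refine ⟨?_, ?_⟩
  · rw [wordProd_cons, hl.1, mul_inv_rev, ← mul_assoc, mul_inv_cancel, one_mul]
  · rw [List.length_cons, hl.2, card_inversions_mul_of_gt h]

lemma IsShortWord.of_cons {l : List (Fin (n - 1))} {p : Perm (Fin n)} {a : Fin (n - 1)}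
    (hl : IsShortWord (a :: l) p) :
    p (hi a) < p (lo a) ∧ IsShortWord l (p * simpleTransposition a) := by
  have hw : wordProd l = (p * simpleTransposition a)⁻¹ := by
    rw [mul_inv_rev, ← hl.1, wordProd_cons, ← mul_assoc, inv_mul_cancel, one_mul]
  have hle := card_inversions_le_length l
  rw [hw, inv_inv] at hle
  have hlen := hl.2
  rw [List.length_cons] at hlen
  rcases lt_or_gt_lo_hi p a with h | h
  · have := card_inversions_mul_of_lt h
    omega
  · have := card_inversions_mul_of_gt h
    exact ⟨h, hw, by omega⟩

lemma exists_isShortWord (p : Perm (Fin n)) : ∃ l, IsShortWord l p := by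
  induction hN : (inversions p).card generalizing p with
  | zero =>
    refine ⟨[], ?_, by simp [hN]⟩
    rw [eq_one_of_forall_lt (p := p) fun a => ?_]
    · simp [wordProd]
    · refine (lt_or_gt_lo_hi p a).resolve_right fun h => ?_
      have := card_inversions_mul_of_gt h
      omega
  | succ N ih =>
    by_cases hd : ∃ a, p (hi a) < p (lo a)
    · obtain ⟨a, ha⟩ := hd
      have := card_inversions_mul_of_gt ha
      obtain ⟨l, hl⟩ := ih (p * simpleTransposition a) (by omega)
      exact ⟨a :: l, hl.cons ha⟩
    · push Not at hd
      have h1 : p = 1 := eq_one_of_forall_lt fun a =>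
        (lt_or_gt_lo_hi p a).resolve_right (hd a).not_gt
      simp [h1] at hN

lemma isReducedWord_iff {l : List (Fin (n - 1))} {w : Perm (Fin n)} :
    IsReducedWord l w ↔ IsShortWord l w⁻¹ := by
  constructor
  · rintro ⟨rfl, hmin⟩
    obtain ⟨l', hl', hlen⟩ := exists_isShortWord (wordProd l)⁻¹
    refine ⟨(inv_inv _).symm, le_antisymm ?_ (card_inversions_le_length l)⟩
    exact (hmin l' (by rw [hl', inv_inv])).trans hlen.le
  · rintro ⟨hw, hlen⟩
    rw [inv_inv] at hw
    refine ⟨hw, fun l' hl' => ?_⟩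
    rw [hlen, ← hl']
    exact card_inversions_le_length _

/-! ### Full commutativity and avoidance of the pattern 321 -/

/-- The permutation has no decreasing subsequence of length three. -/
def Avoids321 (p : Perm (Fin n)) : Prop :=
  ∀ i j k, i < j → j < k → p j < p i → ¬ p k < p j

lemma Avoids321.mul {p : Perm (Fin n)} {a : Fin (n - 1)} (hp : Avoids321 p)
    (h : p (hi a) < p (lo a)) : Avoids321 (p * simpleTransposition a) := by
  have mono : ∀ {x y}, x < y → (p * simpleTransposition a) y < (p * simpleTransposition a) x →
      simpleTransposition a x < simpleTransposition a y := by
    intro x y hxy hlt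
    refine simpleTransposition_lt a hxy ?_
    rintro ⟨rfl, rfl⟩
    simp only [Perm.mul_apply, simpleTransposition_lo, simpleTransposition_hi] at hlt
    exact lt_asymm h hlt
  exact fun i j k hij hjk hji hkj => hp _ _ _ (mono hij hji) (mono hjk hkj) hji hkj

lemma _root_.CommStep.cons {l l' : List (Fin (n - 1))} (a : Fin (n - 1)) (h : CommStep l l') :
    CommStep (a :: l) (a :: l') := by
  obtain ⟨u, v, b, c, hbc, rfl, rfl⟩ := h
  exact ⟨a :: u, v, b, c, hbc, rfl, rfl⟩

lemma _root_.CommEquiv.cons {l l' : List (Fin (n - 1))} (a : Fin (n - 1)) (h : CommEquiv l l') :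
    CommEquiv (a :: l) (a :: l') :=
  Relation.ReflTransGen.lift (a :: ·) (fun _ _ => CommStep.cons a) _ _ h

lemma _root_.CommEquiv.perm_s6 {l l' : List (Fin (n - 1))} (h : CommEquiv l l') : l.Perm l' := by
  induction h with
  | refl => exact List.Perm.refl _
  | tail _ hs ih =>
    obtain ⟨u, v, a, b, -, rfl, rfl⟩ := hs
    exact ih.trans ((List.Perm.swap b a v).append_left u)

/-- Adjacent descents of a 321-avoiding permutation are impossible. -/
lemma Avoids321.not_adjacent {p : Perm (Fin n)} (hp : Avoids321 p) {a b : Fin (n - 1)}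
    (ha : p (hi a) < p (lo a)) (hb : p (hi b) < p (lo b)) : b.1 ≠ a.1 + 1 := by
  intro hab
  have he : lo b = hi a := Fin.ext hab
  rw [he] at hb
  exact hp _ _ _ (lo_lt_hi a) (he ▸ lo_lt_hi b) ha hb

lemma simpleTransposition_comm {a b : Fin (n - 1)} (hab : a.1 + 2 ≤ b.1 ∨ b.1 + 2 ≤ a.1) :
    simpleTransposition a * simpleTransposition b =
      simpleTransposition b * simpleTransposition a := by
  ext x
  simp only [Perm.mul_apply, simpleTransposition_val]
  split_ifs <;> omega

lemma Avoids321.commEquiv {p : Perm (Fin n)} (hp : Avoids321 p) {l l' : List (Fin (n - 1))}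
    (hl : IsShortWord l p) (hl' : IsShortWord l' p) : CommEquiv l l' := by
  induction hN : l.length generalizing p l l' with
  | zero =>
    have h' : l'.length = 0 := by rw [hl'.2, ← hl.2, hN]
    rw [List.length_eq_zero_iff.1 hN, List.length_eq_zero_iff.1 h']
    exact Relation.ReflTransGen.refl
  | succ N ih =>
    have h' : l'.length = N + 1 := by rw [hl'.2, ← hl.2, hN]
    obtain ⟨a, m, rfl⟩ := List.exists_cons_of_length_eq_add_one hN
    obtain ⟨b, m', rfl⟩ := List.exists_cons_of_length_eq_add_one h'
    obtain ⟨ha, hm⟩ := hl.of_cons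
    obtain ⟨hb, hm'⟩ := hl'.of_cons
    simp only [List.length_cons, Nat.add_right_cancel_iff] at hN h'
    by_cases hab : a = b
    · subst hab
      exact (ih (hp.mul ha) hm hm' hN).cons a
    · have h1 := hp.not_adjacent ha hb
      have h2 := hp.not_adjacent hb ha
      have hfar : a.1 + 2 ≤ b.1 ∨ b.1 + 2 ≤ a.1 := by
        have : a.1 ≠ b.1 := fun h => hab (Fin.ext h)
        omega
      have fix : ∀ {c d : Fin (n - 1)}, (c.1 + 2 ≤ d.1 ∨ d.1 + 2 ≤ c.1) → p (hi d) < p (lo d) →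
          (p * simpleTransposition c) (hi d) < (p * simpleTransposition c) (lo d) := by
        intro c d hcd hd
        rw [Perm.mul_apply, Perm.mul_apply, simpleTransposition_of_ne, simpleTransposition_of_ne]
        · exact hd
        all_goals simp only [ne_eq, Fin.ext_iff, lo_val, hi_val]; omega
      obtain ⟨t, ht⟩ :=
        exists_isShortWord (p * simpleTransposition a * simpleTransposition b)
      have hbt : IsShortWord (b :: t) (p * simpleTransposition a) := ht.cons (fix hfar hb)
      rw [mul_assoc, simpleTransposition_comm hfar, ← mul_assoc] at ht
      have hat : IsShortWord (a :: t) (p * simpleTransposition b) := ht.cons (fix hfar.symm ha)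
      have e1 := (ih (hp.mul ha) hm hbt hN).cons a
      have e2 := (ih (hp.mul hb) hat hm' (by rw [hat.2, ← hm'.2, h'])).cons b
      exact (e1.tail ⟨[], t, a, b, hfar, rfl, rfl⟩).trans e2

lemma simpleTransposition_braid {a b : Fin (n - 1)} (hab : b.1 = a.1 + 1) :
    simpleTransposition a * simpleTransposition b * simpleTransposition a =
      simpleTransposition b * simpleTransposition a * simpleTransposition b := by
  have ha : simpleTransposition a = swap (lo a) (hi a) := rfl
  have hb : simpleTransposition b = swap (hi a) (hi b) := by
    rw [show hi a = lo b from Fin.ext hab.symm]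
    rfl
  have h1 : lo a ≠ hi a := (lo_lt_hi a).ne
  have h2 : lo a ≠ hi b := by simp only [ne_eq, Fin.ext_iff, lo_val, hi_val]; omega
  have h3 : hi b ≠ hi a := by simp only [ne_eq, Fin.ext_iff, hi_val]; omega
  rw [ha, hb, swap_mul_swap_mul_swap h1 h2, swap_comm (lo a) (hi a), swap_comm (hi a) (hi b),
    swap_mul_swap_mul_swap h3 h2.symm, swap_comm]

lemma braid_not_perm {a b : Fin (n - 1)} (hab : a ≠ b) (l : List (Fin (n - 1))) :
    ¬ (a :: b :: a :: l).Perm (b :: a :: b :: l) := by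
  intro h
  have := h.count_eq a
  simp [hab.symm] at this

/-- A decreasing subsequence of length three yields two words for the inverse, both of minimal
length, which use different multisets of letters. -/
lemma exists_not_perm (p : Perm (Fin n)) {i j k : Fin n} (hij : i < j) (hjk : j < k)
    (hji : p j < p i) (hkj : p k < p j) :
    ∃ l l', IsShortWord l p ∧ IsShortWord l' p ∧ ¬ l.Perm l' := by
  induction hN : (inversions p).card + (k.1 - i.1) using Nat.strong_induction_on
    generalizing p i j k with
  | _ N ih =>
  subst hN
  have descend : ∀ {a : Fin (n - 1)}, p (hi a) < p (lo a) → (∃ l l',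
      IsShortWord l (p * simpleTransposition a) ∧ IsShortWord l' (p * simpleTransposition a) ∧
        ¬ l.Perm l') → ∃ l l', IsShortWord l p ∧ IsShortWord l' p ∧ ¬ l.Perm l' := by
    rintro a ha ⟨l, l', hl, hl', hne⟩
    exact ⟨a :: l, a :: l', hl.cons ha, hl'.cons ha, fun h => hne ((List.perm_cons a).1 h)⟩
  have hijv : i.1 < j.1 := hij
  have hjkv : j.1 < k.1 := hjk
  have hkn := k.isLt
  by_cases h1 : i.1 + 1 < j.1
  · let a : Fin (n - 1) := ⟨i.1, by omega⟩
    have hia : lo a = i := rfl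
    have haj : hi a < j := h1
    rcases lt_or_gt_of_ne (fun h => haj.ne (p.injective h)) with h | h
    · have hd : p (hi a) < p (lo a) := by rw [hia]; exact h.trans hji
      have hc := card_inversions_mul_of_gt hd
      have hj : simpleTransposition a j = j := simpleTransposition_of_ne a hij.ne' haj.ne'
      have hk : simpleTransposition a k = k :=
        simpleTransposition_of_ne a (hij.trans hjk).ne' (haj.trans hjk).ne'
      refine descend hd (ih _ ?_ (p * simpleTransposition a) (i := hi a) haj hjk ?_ ?_ rfl)
      · have : (hi a).1 = i.1 + 1 := rfl
        omega
      · simpa [hj, hia] using hji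
      · simpa [hj, hk] using hkj
    · refine ih _ ?_ p (i := hi a) haj hjk h hkj rfl
      have : (hi a).1 = i.1 + 1 := rfl
      omega
  · by_cases h2 : j.1 + 1 < k.1
    · let a : Fin (n - 1) := ⟨k.1 - 1, by omega⟩
      have hka : hi a = k := Fin.ext (by simp only [hi_val, a]; omega)
      have hav : (lo a).1 = k.1 - 1 := rfl
      have hja : j < lo a := by rw [Fin.lt_def]; omega
      rcases lt_or_gt_of_ne (fun h => hja.ne (p.injective h)) with h | h
      · have hd : p (hi a) < p (lo a) := by rw [hka]; exact hkj.trans h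
        have hc := card_inversions_mul_of_gt hd
        have hj : simpleTransposition a j = j :=
          simpleTransposition_of_ne a hja.ne (hka ▸ hjk.ne)
        have hia : simpleTransposition a i = i :=
          simpleTransposition_of_ne a (hij.trans hja).ne (hka ▸ (hij.trans hjk).ne)
        refine descend hd (ih _ ?_ (p * simpleTransposition a) (k := lo a) hij hja ?_ ?_ rfl)
        · omega
        · simpa [hj, hia] using hji
        · simpa [hj, hka] using hkj
      · exact ih _ (by omega) p (k := lo a) hij hja hji h rfl
    · let a : Fin (n - 1) := ⟨i.1, by omega⟩
      let b : Fin (n - 1) := ⟨i.1 + 1, by omega⟩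
      have hab : a ≠ b := by simp [a, b, Fin.ext_iff]
      have hla : lo a = i := rfl
      have hha : hi a = j := Fin.ext (by simp only [hi_val, a]; omega)
      have hlb : lo b = j := Fin.ext (by simp only [lo_val, b]; omega)
      have hhb : hi b = k := Fin.ext (by simp only [hi_val, b]; omega)
      have sai : simpleTransposition a i = j := by rw [← hla, simpleTransposition_lo, hha]
      have saj : simpleTransposition a j = i := by rw [← hha, simpleTransposition_hi, hla]
      have sak : simpleTransposition a k = k :=
        simpleTransposition_of_ne a (hij.trans hjk).ne' (hha ▸ hjk.ne')
      have sbj : simpleTransposition b j = k := by rw [← hlb, simpleTransposition_lo, hhb]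
      have sbk : simpleTransposition b k = j := by rw [← hhb, simpleTransposition_hi, hlb]
      have sbi : simpleTransposition b i = i :=
        simpleTransposition_of_ne b (hlb ▸ hij.ne) (hhb ▸ (hij.trans hjk).ne)
      have braid := simpleTransposition_braid (a := a) (b := b) rfl
      obtain ⟨l, hl⟩ := exists_isShortWord (p * simpleTransposition a * simpleTransposition b *
        simpleTransposition a)
      have hl' : IsShortWord l (p * simpleTransposition b * simpleTransposition a *
          simpleTransposition b) := by
        simpa only [mul_assoc, ← braid] using hl
      refine ⟨a :: b :: a :: l, b :: a :: b :: l, ?_, ?_, braid_not_perm hab l⟩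
      · refine .cons ?_ (.cons ?_ (.cons ?_ hl)) <;>
          simp only [hla, hha, hlb, hhb, Perm.mul_apply, sai, saj, sak, sbi, sbj]
        exacts [hji, hkj.trans hji, hkj]
      · refine .cons ?_ (.cons ?_ (.cons ?_ hl')) <;>
          simp only [hla, hha, hlb, hhb, Perm.mul_apply, saj, sak, sbi, sbj, sbk]
        exacts [hkj, hkj.trans hji, hji]

theorem fullyCommutative_iff_avoids321_inv {w : Perm (Fin n)} :
    FullyCommutative w ↔ Avoids321 w⁻¹ := by
  constructor
  · intro hw i j k hij hjk hji hkj
    obtain ⟨l, l', hl, hl', hne⟩ := exists_not_perm w⁻¹ hij hjk hji hkj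
    exact hne (CommEquiv.perm_s6 (hw l l' (isReducedWord_iff.2 hl) (isReducedWord_iff.2 hl')))
  · exact fun hw l l' hl hl' => hw.commEquiv (isReducedWord_iff.1 hl) (isReducedWord_iff.1 hl')

/-! ### Counting permutations avoiding 321 -/

/-- Prepend the value `v` to the one-line notation of `q`, relabelling the values of `q`. -/
def consPerm (x : Fin (n + 1) × Perm (Fin n)) : Perm (Fin (n + 1)) :=
  (finSuccEquiv n).trans ((optionCongr x.2).trans (finSuccEquiv' x.1).symm)

@[simp] lemma consPerm_zero (v : Fin (n + 1)) (q : Perm (Fin n)) : consPerm (v, q) 0 = v := by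
  simp [consPerm]

@[simp] lemma consPerm_succ (v : Fin (n + 1)) (q : Perm (Fin n)) (i : Fin n) :
    consPerm (v, q) i.succ = v.succAbove (q i) := by
  simp [consPerm]

lemma consPerm_bijective : Function.Bijective (consPerm (n := n)) := by
  rw [Fintype.bijective_iff_injective_and_card]
  refine ⟨?_, by simp [Fintype.card_perm, Nat.factorial_succ]⟩
  rintro ⟨v, q⟩ ⟨v', q'⟩ h
  have hv : v = v' := by simpa using DFunLike.congr_fun h 0
  subst hv
  congr 1
  ext i
  have := DFunLike.congr_fun h i.succ
  simp only [consPerm_succ, Fin.succAbove_right_inj] at this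
  rw [this]

/-- `p` avoids 321, and its values smaller than `k` occur in increasing order. -/
def Good (k : ℕ) (p : Perm (Fin n)) : Prop :=
  Avoids321 p ∧ ∀ i j, i < j → p j < p i → k ≤ (p i).1

lemma good_consPerm_iff (k : ℕ) (v : Fin (n + 1)) (q : Perm (Fin n)) :
    Good k (consPerm (v, q)) ↔ (v.1 = 0 ∧ Good (k - 1) q) ∨ (0 < v.1 ∧ k ≤ v.1 ∧ Good v.1 q) := by
  have val : ∀ x : Fin n, (v.succAbove x).1 = if x.1 < v.1 then x.1 else x.1 + 1 := by
    intro x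
    simp only [Fin.succAbove, Fin.lt_def, Fin.val_castSucc]
    split_ifs <;> simp
  have below : ∀ x : Fin n, v.succAbove x < v ↔ x.1 < v.1 := by
    intro x
    rw [Fin.lt_def, val]
    split_ifs <;> omega
  constructor
  · rintro ⟨hav, hinc⟩
    have hq : Avoids321 q := by
      intro a b c hab hbc hba hcb
      refine hav a.succ b.succ c.succ ?_ ?_ ?_ ?_ <;> simpa
    have hinc' : ∀ i j, i < j → q j < q i → k ≤ (v.succAbove (q i)).1 := by
      intro i j hij hji
      simpa using hinc i.succ j.succ (by simpa) (by simpa)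
    rcases Nat.eq_zero_or_pos v.1 with hv | hv
    · refine Or.inl ⟨hv, hq, fun i j hij hji => ?_⟩
      have := hinc' i j hij hji
      rw [val] at this
      split_ifs at this <;> omega
    · refine Or.inr ⟨hv, ?_, hq, fun i j hij hji => ?_⟩
      · have hn : 0 < n := by have := v.isLt; omega
        have := hinc 0 (q.symm ⟨0, hn⟩).succ (Fin.succ_pos _)
        simp only [consPerm_succ, consPerm_zero, apply_symm_apply, below] at this
        exact this hv
      · by_contra hlt
        refine hav 0 i.succ j.succ (Fin.succ_pos _) (by simpa) ?_ (by simpa)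
        simp only [consPerm_succ, consPerm_zero, below]
        omega
  · intro h
    have hq : Good v.1 q := by
      rcases h with ⟨hv, hg⟩ | ⟨-, -, hg⟩
      · exact ⟨hg.1, fun i j _ _ => by omega⟩
      · exact hg
    refine ⟨?_, ?_⟩
    · intro a b c hab hbc hba hcb
      obtain ⟨b, rfl⟩ := Fin.exists_succ_eq.2 (Fin.ne_zero_of_lt hab)
      obtain ⟨c, rfl⟩ := Fin.exists_succ_eq.2 (Fin.ne_zero_of_lt hbc)
      simp only [consPerm_succ, Fin.succAbove_lt_succAbove_iff] at hcb
      rw [Fin.succ_lt_succ_iff] at hbc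
      cases a using Fin.cases with
      | zero =>
        simp only [consPerm_succ, consPerm_zero, below] at hba
        have := hq.2 b c hbc hcb
        omega
      | succ a =>
        simp only [consPerm_succ, Fin.succAbove_lt_succAbove_iff] at hba
        exact hq.1 a b c (by simpa using hab) hbc hba hcb
    · intro a b hab hba
      obtain ⟨b, rfl⟩ := Fin.exists_succ_eq.2 (Fin.ne_zero_of_lt hab)
      cases a using Fin.cases with
      | zero =>
        simp only [consPerm_succ, consPerm_zero, below] at hba ⊢
        omega
      | succ a =>
        simp only [consPerm_succ, Fin.succAbove_lt_succAbove_iff] at hba ⊢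
        rw [Fin.succ_lt_succ_iff] at hab
        rw [val]
        rcases h with ⟨hv, hg⟩ | ⟨-, hk, hg⟩
        · have := hg.2 a b hab hba
          split_ifs <;> omega
        · have := hg.2 a b hab hba
          split_ifs <;> omega

/-- The number of permutations of `Fin n` avoiding 321 whose values smaller than `k` occur in
increasing order. -/
noncomputable def numGood (n k : ℕ) : ℕ := Nat.card {p : Perm (Fin n) // Good k p}

lemma numGood_succ (n k : ℕ) :
    numGood (n + 1) k =
      numGood n (k - 1) + ∑ v ∈ Ico (max k 1) (n + 1), numGood n v := by
  classical
  have hsum : numGood (n + 1) k =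
      ∑ v : Fin (n + 1), Nat.card {q : Perm (Fin n) // Good k (consPerm (v, q))} := by
    rw [← Nat.card_sigma, numGood]
    refine (Nat.card_congr ?_).symm
    refine Equiv.trans ?_ ((Equiv.ofBijective _ consPerm_bijective).subtypeEquivOfSubtype)
    exact ⟨fun x => ⟨(x.1, x.2.1), x.2.2⟩, fun x => ⟨x.1.1, ⟨x.1.2, x.2⟩⟩,
      fun _ => rfl, fun _ => rfl⟩
  have hterm : ∀ v : Fin (n + 1), Nat.card {q : Perm (Fin n) // Good k (consPerm (v, q))} =
      if v.1 = 0 then numGood n (k - 1) else if k ≤ v.1 then numGood n v.1 else 0 := by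
    intro v
    simp only [good_consPerm_iff]
    split_ifs with h0 hk
    · simp [h0, numGood]
    · simp [h0, hk, Nat.pos_of_ne_zero h0, numGood]
    · simp [h0, hk]
  rw [hsum, Finset.sum_congr rfl fun v _ => hterm v,
    Fin.sum_univ_eq_sum_range
      (fun v => if v = 0 then numGood n (k - 1) else if k ≤ v then numGood n v else 0),
    Finset.range_eq_Ico, Finset.sum_eq_sum_Ico_succ_bot (Nat.succ_pos n), if_pos rfl]
  congr 1
  have hset : Ico (max k 1) (n + 1) = (Ico (0 + 1) (n + 1)).filter (k ≤ ·) := by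
    ext x
    simp only [mem_Ico, mem_filter]
    omega
  rw [hset, Finset.sum_filter]
  refine Finset.sum_congr rfl fun x hx => ?_
  rw [if_neg (by have := mem_Ico.1 hx; omega)]

lemma numGood_zero : numGood 0 0 = 1 := by
  have : Unique {p : Perm (Fin 0) // Good 0 p} :=
    ⟨⟨⟨1, fun i => i.elim0, fun i => i.elim0⟩⟩, fun _ => Subsingleton.elim _ _⟩
  exact Nat.card_unique

/-- The ballot number formula. -/
lemma numGood_add_choose (n k d : ℕ) (h : k + d = n) :
    numGood n k + (n + d).choose (n + 1) = (n + d).choose n := by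
  induction n generalizing k d with
  | zero =>
    obtain ⟨rfl, rfl⟩ : k = 0 ∧ d = 0 := by omega
    simp [numGood_zero]
  | succ n ih =>
    induction d generalizing k with
    | zero =>
      obtain rfl : k = n + 1 := h
      have := ih n 0 rfl
      rw [numGood_succ, max_eq_left (by omega), Finset.Ico_self]
      simpa using this
    | succ d ihd =>
      have h1 := ihd (k + 1) (by omega)
      rw [numGood_succ, max_eq_left (by omega), Nat.add_sub_cancel] at h1
      have hp1 := Nat.choose_succ_succ (n + 1 + d) n
      have hp2 := Nat.choose_succ_succ (n + 1 + d) (n + 1)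
      simp only [Nat.succ_eq_add_one] at hp1 hp2
      rw [← add_assoc, numGood_succ]
      rcases Nat.eq_zero_or_pos k with rfl | hk
      · obtain rfl : d = n := by omega
        have hsymm : (d + 1 + d).choose (d + 1) = (d + 1 + d).choose d :=
          Nat.choose_symm_of_eq_add rfl
        simp only [max_eq_right (Nat.zero_le 1), Nat.zero_sub]
        simp only [Nat.zero_add] at h1
        omega
      · have h2 := ih (k - 1) (d + 1) (by omega)
        rw [show n + (d + 1) = n + 1 + d by omega] at h2
        rw [max_eq_left hk, Finset.sum_eq_sum_Ico_succ_bot (by omega : k < n + 1)]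
        omega

end FullyCommutativeCount

open FullyCommutativeCount in
/-- The number of fully commutative elements of `S_n` equals the `n`-th Catalan number
`(1/(n+1))·C(2n, n)`. -/
theorem card_fullyCommutative_eq_catalan (n : ℕ) (hn : 1 ≤ n) :
    Nat.card {w : Equiv.Perm (Fin n) // FullyCommutative w} =
      Nat.choose (2 * n) n / (n + 1) := by
  have hcard : Nat.card {w : Equiv.Perm (Fin n) // FullyCommutative w} = numGood n 0 :=
    Nat.card_congr <| (Equiv.inv _).subtypeEquiv fun w => by
      simp [fullyCommutative_iff_avoids321_inv, Good]
  have hballot := numGood_add_choose n 0 n (Nat.zero_add n)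
  have hchoose := Nat.choose_succ_right_eq (2 * n) n
  rw [← two_mul] at hballot
  rw [show 2 * n - n = n by omega] at hchoose
  rw [hcard]
  refine (Nat.div_eq_of_eq_mul_left n.succ_pos ?_).symm
  linarith [congrArg (· * (n + 1)) hballot]
end
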